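/- Let n ≥ 1 and let α_1,...,α_{2n} be complex numbers such that Σ_{i=1}^{2n} α_i^k = 0 for every odd integer k with 1 ≤ k ≤ 2n−1. Then the tuple (α_1,...,α_{2n}) is binary: there exists a fixed-point-free involution σ of {1,...,2n} with α_{σ(i)} = −α_i for all i. -/

import Mathlib

noncomputable section

/-- If the power sums of odd degree at most `m` vanish, so do the elementary symmetric functions
of odd degree at most `m`, by Newton's identities. -/
theorem esymm_eq_zero_of_odd_power_sums_vanish {ι K : Type*} [Fintype ι] [Field K] [CharZero K]
    (α : ι → K) (m : ℕ) (h : ∀ k, Odd k → k ≤ m → ∑ i, α i ^ k = 0) (k : ℕ) (hk : Odd k)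
    (hkm : k ≤ m) : (Finset.univ.val.map α).esymm k = 0 := by
  induction k using Nat.strong_induction_on with
  | _ k ih =>
    have newton := congrArg (MvPolynomial.aeval α) (MvPolynomial.mul_esymm_eq_sum ι K k)
    simp only [map_mul, map_natCast, map_sum, map_pow, map_neg, map_one,
      MvPolynomial.aeval_esymm_eq_multiset_esymm, MvPolynomial.psum, MvPolynomial.aeval_X]
      at newton
    rw [Finset.sum_eq_zero, mul_zero] at newton
    · exact (mul_eq_zero.mp newton).resolve_left (Nat.cast_ne_zero.mpr hk.pos.ne')
    · intro p hp
      obtain ⟨hp, hlt⟩ := Finset.mem_filter.mp hp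
      have hsum := Finset.HasAntidiagonal.mem_antidiagonal.mp hp
      rcases Nat.even_or_odd p.1 with h1 | h1
      · rw [h p.2 (by grind) (by omega), mul_zero]
      · rw [ih p.1 hlt h1 (by omega), mul_zero, zero_mul]

/-- A multiset is determined by its cardinality and its elementary symmetric functions. -/
theorem Multiset.eq_of_card_eq_of_esymm_eq {R : Type*} [CommRing R] [IsDomain R]
    {s t : Multiset R} (hcard : card s = card t) (h : ∀ k ≤ card s, s.esymm k = t.esymm k) :
    s = t := by
  rw [← Polynomial.roots_multiset_prod_X_sub_C s, ← Polynomial.roots_multiset_prod_X_sub_C t,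
    Multiset.prod_X_sub_X_eq_sum_esymm, Multiset.prod_X_sub_X_eq_sum_esymm, ← hcard]
  congr 1
  refine Finset.sum_congr rfl fun k hk => ?_
  rw [h k (Nat.lt_succ_iff.mp (Finset.mem_range.mp hk))]

/-- A finite family of even size whose multiset of values is stable under negation can be paired
off into opposite values. -/
theorem Finset.exists_pairing_neg_of_map_neg_eq {ι K : Type*} [DecidableEq ι] [Field K]
    [CharZero K] (α : ι → K) (s : Finset ι) (hs : Even s.card)
    (hneg : (s.val.map α).map Neg.neg = s.val.map α) :
    ∃ σ : ι → ι, ∀ i ∈ s, σ i ∈ s ∧ σ i ≠ i ∧ σ (σ i) = i ∧ α (σ i) = -α i := by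
  induction s using Finset.strongInduction with
  | H s ih =>
    rcases s.eq_empty_or_nonempty with rfl | hne
    · exact ⟨id, by simp⟩
    obtain ⟨i, hi, j, hj, hij, hα⟩ : ∃ i ∈ s, ∃ j ∈ s, j ≠ i ∧ α j = -α i := by
      by_cases hzero : ∀ i ∈ s, α i = 0
      · obtain ⟨i, hi⟩ := hne
        obtain ⟨j, hj, hij⟩ := s.exists_mem_ne (by
          have := Finset.card_pos.mpr ⟨i, hi⟩
          grind) i
        exact ⟨i, hi, j, hj, hij, by simp [hzero i hi, hzero j hj]⟩
      · push Not at hzero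
        obtain ⟨i, hi, hαi⟩ := hzero
        have hmem : -α i ∈ s.val.map α := by
          rw [← hneg]
          exact Multiset.mem_map_of_mem _ (Multiset.mem_map_of_mem _ hi)
        obtain ⟨j, hj, hα⟩ := Multiset.mem_map.mp hmem
        refine ⟨i, hi, j, hj, ?_, hα⟩
        rintro rfl
        exact hαi (self_eq_neg.mp hα)
    obtain ⟨t, rfl, hit, hjt⟩ : ∃ t, s = insert i (insert j t) ∧ i ∉ insert j t ∧ j ∉ t :=
      ⟨(s.erase i).erase j, by grind, by grind, by grind⟩
    have ht : Even t.card := by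
      rw [Finset.card_insert_of_notMem hit, Finset.card_insert_of_notMem hjt] at hs
      grind
    rw [Finset.insert_val_of_notMem hit, Finset.insert_val_of_notMem hjt] at hneg
    simp only [Multiset.map_cons, hα, neg_neg] at hneg
    rw [Multiset.cons_swap, Multiset.cons_inj_right, Multiset.cons_inj_right] at hneg
    obtain ⟨σ, hσ⟩ := ih t (by grind) ht hneg
    refine ⟨fun x => if x = i then j else if x = j then i else σ x, fun x hx => ?_⟩
    have hit' : i ∉ t := fun hmem => hit (Finset.mem_insert_of_mem hmem)
    rcases eq_or_ne x i with rfl | hxi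
    · simp [hij, hα]
    rcases eq_or_ne x j with rfl | hxj
    · simp [hij, hij.symm, hα]
    have hxt : x ∈ t := by simpa [hxi, hxj] using hx
    obtain ⟨hmem, hfix, hinv, hval⟩ := hσ x hxt
    have hσi : σ x ≠ i := ne_of_mem_of_not_mem hmem hit'
    have hσj : σ x ≠ j := ne_of_mem_of_not_mem hmem hjt
    simp [hxi, hxj, hσi, hσj, hmem, hfix, hinv, hval]

theorem binary_of_odd_power_sums_vanish
    (n : ℕ) (hn : 1 ≤ n)
    (α : Fin (2 * n) → ℂ)
    (h : ∀ k : ℕ, Odd k → 1 ≤ k → k ≤ 2 * n - 1 → ∑ i, (α i) ^ k = 0) :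
    ∃ σ : Equiv.Perm (Fin (2 * n)),
      (∀ i, σ i ≠ i) ∧ (∀ i, σ (σ i) = i) ∧ ∀ i, α (σ i) = -α i := by
  have hodd := esymm_eq_zero_of_odd_power_sums_vanish α (2 * n - 1)
    fun k hk hkn => h k hk hk.pos hkn
  have hneg : (Finset.univ.val.map α).map Neg.neg = Finset.univ.val.map α := by
    refine Multiset.eq_of_card_eq_of_esymm_eq (by simp) fun k hk => ?_
    have hk : k ≤ 2 * n := by simpa using hk
    rw [Multiset.esymm_neg]
    rcases Nat.even_or_odd k with hev | hk_odd
    · rw [hev.neg_one_pow, one_mul]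
    · rw [hodd k hk_odd (by grind), mul_zero]
  obtain ⟨σ, hσ⟩ := Finset.exists_pairing_neg_of_map_neg_eq α Finset.univ (by simp) hneg
  have hinv : Function.Involutive σ := fun i => (hσ i (Finset.mem_univ i)).2.2.1
  exact ⟨hinv.toPerm, fun i => (hσ i (Finset.mem_univ i)).2.1, hinv,
    fun i => (hσ i (Finset.mem_univ i)).2.2.2⟩
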